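/- Saturated propagator of the BHT (new massive gravity) model: let β > 0, κ ≠ 0, Λ ≠ 0, set σ = −1, α = −3β/8 and m₂² := 4/(βκ²), and let k ∈ ℝ³ satisfy k² ∉ {0, m₂²}. Then for every conserved symmetric current T^{μν} (k_μT^{μν} = 0), the saturated propagator SP := T^{μν}(𝒪⁻¹)_{μν,κλ}T^{κλ} equals [1/(k² − m₂²) − 1/k²](T_{μν}T^{μν} − ½T²) + T²/(2k²); in particular its residue at the massive pole k² = m₂² is T_{μν}T^{μν} − ½T² and its residue at the massless pole k² = 0 is −(T_{μν}T^{μν} − T²). -/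

import Mathlib

open BigOperators Topology Filter

noncomputable section

/-- The 3D Minkowski metric η = diag(1, -1, -1). -/
def eta : Fin 3 → Fin 3 → ℝ :=
  fun μ ν => if μ = ν then (if μ = 0 then 1 else -1) else 0

/-- Lowered index: k_μ = η_{μν} k^ν. -/
def lowerIdx (k : Fin 3 → ℝ) (μ : Fin 3) : ℝ := ∑ ν, eta μ ν * k ν

/-- Minkowski square k² = η_{μν} k^μ k^ν. -/
def ksq (k : Fin 3 → ℝ) : ℝ := ∑ μ, ∑ ν, eta μ ν * k μ * k ν

/-- Transverse projector θ_{μν} = η_{μν} - k_μ k_ν / k². -/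
def θt (k : Fin 3 → ℝ) (μ ν : Fin 3) : ℝ :=
  eta μ ν - lowerIdx k μ * lowerIdx k ν / ksq k

/-- Longitudinal projector ω_{μν} = k_μ k_ν / k². -/
def ωt (k : Fin 3 → ℝ) (μ ν : Fin 3) : ℝ :=
  lowerIdx k μ * lowerIdx k ν / ksq k

/-- Rank-4 tensors (operators on symmetric rank-2 tensors), all indices down. -/
abbrev Tensor4 := Fin 3 → Fin 3 → Fin 3 → Fin 3 → ℝ

/-- Barnes–Rivers spin-2 projector. -/
def P2 (k : Fin 3 → ℝ) : Tensor4 := fun μ ν κ lam =>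
  (1/2) * (θt k μ κ * θt k ν lam + θt k μ lam * θt k ν κ - θt k μ ν * θt k κ lam)

/-- Barnes–Rivers spin-1 projector. -/
def P1 (k : Fin 3 → ℝ) : Tensor4 := fun μ ν κ lam =>
  (1/2) * (θt k μ κ * ωt k ν lam + θt k μ lam * ωt k ν κ +
           θt k ν lam * ωt k μ κ + θt k ν κ * ωt k μ lam)

/-- Barnes–Rivers spin-0 (s) projector. -/
def P0s (k : Fin 3 → ℝ) : Tensor4 := fun μ ν κ lam =>
  (1/2) * (θt k μ ν * θt k κ lam)

/-- Barnes–Rivers spin-0 (w) projector. -/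
def P0w (k : Fin 3 → ℝ) : Tensor4 := fun μ ν κ lam =>
  ωt k μ ν * ωt k κ lam

/-- Barnes–Rivers transfer operator P^{(0-sw)}. -/
def P0sw (k : Fin 3 → ℝ) : Tensor4 := fun μ ν κ lam =>
  (1 / Real.sqrt 2) * (θt k μ ν * ωt k κ lam)

/-- Barnes–Rivers transfer operator P^{(0-ws)}. -/
def P0ws (k : Fin 3 → ℝ) : Tensor4 := fun μ ν κ lam =>
  (1 / Real.sqrt 2) * (ωt k μ ν * θt k κ lam)

/-- Contraction product (A·B)_{μν,κλ} = A_{μν}{}^{ρσ} B_{ρσ,κλ}, indices raised with η. -/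
def bprod (A B : Tensor4) : Tensor4 := fun μ ν κ lam =>
  ∑ ρ, ∑ σ, ∑ ρ', ∑ σ', A μ ν ρ σ * eta ρ ρ' * eta σ σ' * B ρ' σ' κ lam

/-- Saturation T^{μν} P_{μν,κλ} T^{κλ} of a rank-4 operator with a current. -/
def satur (P : Tensor4) (T : Fin 3 → Fin 3 → ℝ) : ℝ :=
  ∑ μ, ∑ ν, ∑ κ, ∑ lam, T μ ν * P μ ν κ lam * T κ lam

/-- Trace T = η_{μν} T^{μν}. -/
def trT (T : Fin 3 → Fin 3 → ℝ) : ℝ := ∑ μ, ∑ ν, eta μ ν * T μ ν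

/-- Square T_{μν}T^{μν} = η_{μα} η_{νβ} T^{αβ} T^{μν}. -/
def Tsq (T : Fin 3 → Fin 3 → ℝ) : ℝ :=
  ∑ μ, ∑ ν, ∑ α, ∑ β, eta μ α * eta ν β * T α β * T μ ν

open Matrix

lemma satur_add (P Q : Tensor4) (T : Fin 3 → Fin 3 → ℝ) :
    satur (P + Q) T = satur P T + satur Q T := by
  simp only [satur, Pi.add_apply, mul_add, add_mul, Finset.sum_add_distrib]

lemma satur_smul (c : ℝ) (P : Tensor4) (T : Fin 3 → Fin 3 → ℝ) :
    satur (c • P) T = c * satur P T := by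
  simp only [satur, Pi.smul_apply, smul_eq_mul, Finset.mul_sum]
  refine Finset.sum_congr rfl fun _ _ => Finset.sum_congr rfl fun _ _ =>
    Finset.sum_congr rfl fun _ _ => Finset.sum_congr rfl fun _ _ => ?_
  ring

/-- The operator `A_{μν} B_{κλ}`. -/
def outerTensor (A B : Matrix (Fin 3) (Fin 3) ℝ) : Tensor4 := fun μ ν κ lam => A μ ν * B κ lam

/-- The operator `A_{μκ} B_{νλ}`. -/
def crossTensor (A B : Matrix (Fin 3) (Fin 3) ℝ) : Tensor4 := fun μ ν κ lam => A μ κ * B ν lam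

/-- The operator `A_{μλ} B_{νκ}`. -/
def swapTensor (A B : Matrix (Fin 3) (Fin 3) ℝ) : Tensor4 := fun μ ν κ lam => A μ lam * B ν κ

lemma satur_outerTensor (A B : Matrix (Fin 3) (Fin 3) ℝ) (T : Fin 3 → Fin 3 → ℝ) :
    satur (outerTensor A B) T = (Aᵀ * of T).trace * (Bᵀ * of T).trace := by
  simp [satur, outerTensor, Matrix.trace, Matrix.mul_apply, Fin.sum_univ_three]
  ring

lemma satur_crossTensor (A B : Matrix (Fin 3) (Fin 3) ℝ) (T : Fin 3 → Fin 3 → ℝ) :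
    satur (crossTensor A B) T = (A * of T * (of T * B)ᵀ).trace := by
  simp [satur, crossTensor, Matrix.trace, Matrix.mul_apply, Fin.sum_univ_three]
  ring

lemma satur_swapTensor (A B : Matrix (Fin 3) (Fin 3) ℝ) {T : Fin 3 → Fin 3 → ℝ}
    (hsymm : ∀ μ ν, T μ ν = T ν μ) :
    satur (swapTensor A B) T = satur (crossTensor A B) T := by
  unfold satur swapTensor crossTensor
  refine Finset.sum_congr rfl fun μ _ => Finset.sum_congr rfl fun ν _ => ?_
  rw [Finset.sum_comm]
  refine Finset.sum_congr rfl fun κ _ => Finset.sum_congr rfl fun lam _ => ?_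
  rw [hsymm lam κ]

lemma P2_eq (k : Fin 3 → ℝ) : P2 k = (1 / 2 : ℝ) • (crossTensor (of (θt k)) (of (θt k)) +
    swapTensor (of (θt k)) (of (θt k)) + (-1 : ℝ) • outerTensor (of (θt k)) (of (θt k))) := by
  ext μ ν κ lam
  simp [P2, crossTensor, swapTensor, outerTensor]
  ring

lemma P1_eq (k : Fin 3 → ℝ) : P1 k = (1 / 2 : ℝ) • (crossTensor (of (θt k)) (of (ωt k)) +
    swapTensor (of (θt k)) (of (ωt k)) + crossTensor (of (ωt k)) (of (θt k)) +
    swapTensor (of (ωt k)) (of (θt k))) := by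
  ext μ ν κ lam
  simp [P1, crossTensor, swapTensor]
  ring

lemma P0s_eq (k : Fin 3 → ℝ) : P0s k = (1 / 2 : ℝ) • outerTensor (of (θt k)) (of (θt k)) := rfl

lemma P0w_eq (k : Fin 3 → ℝ) : P0w k = outerTensor (of (ωt k)) (of (ωt k)) := rfl

lemma P0sw_eq (k : Fin 3 → ℝ) :
    P0sw k = (1 / Real.sqrt 2) • outerTensor (of (θt k)) (of (ωt k)) := rfl

lemma P0ws_eq (k : Fin 3 → ℝ) :
    P0ws k = (1 / Real.sqrt 2) • outerTensor (of (ωt k)) (of (θt k)) := rfl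

lemma eta_comm (μ ν : Fin 3) : eta μ ν = eta ν μ := by
  fin_cases μ <;> fin_cases ν <;> rfl

lemma transpose_ωt (k : Fin 3 → ℝ) : (of (ωt k))ᵀ = of (ωt k) := by
  ext μ ν
  simp [ωt, mul_comm]

lemma θt_eq_eta_sub_ωt (k : Fin 3 → ℝ) : of (θt k) = of eta - of (ωt k) := rfl

lemma transpose_eta : (of eta)ᵀ = of eta := by
  ext μ ν
  exact eta_comm ν μ

lemma transpose_θt (k : Fin 3 → ℝ) : (of (θt k))ᵀ = of (θt k) := by
  rw [θt_eq_eta_sub_ωt, transpose_sub, transpose_eta, transpose_ωt]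

lemma trace_eta_mul (T : Fin 3 → Fin 3 → ℝ) : (of eta * of T).trace = trT T := by
  simp [trT, eta, Matrix.trace, Matrix.mul_apply, Fin.sum_univ_three]

lemma satur_crossTensor_eta (T : Fin 3 → Fin 3 → ℝ) :
    satur (crossTensor (of eta) (of eta)) T = Tsq T := by
  unfold satur crossTensor Tsq
  refine Finset.sum_congr rfl fun _ _ => Finset.sum_congr rfl fun _ _ =>
    Finset.sum_congr rfl fun _ _ => Finset.sum_congr rfl fun _ _ => ?_
  simp only [of_apply]
  ring

section Conserved

variable {k : Fin 3 → ℝ} {T : Fin 3 → Fin 3 → ℝ}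

lemma ωt_mul_of_conserved (hcons : ∀ ν, ∑ μ, lowerIdx k μ * T μ ν = 0) :
    of (ωt k) * of T = 0 := by
  ext μ ν
  have h : ∀ j, ωt k μ j * T j ν = lowerIdx k μ / ksq k * (lowerIdx k j * T j ν) := by
    intro j
    simp only [ωt]
    ring
  simp [Matrix.mul_apply, h, ← Finset.mul_sum, hcons]

lemma mul_ωt_of_conserved (hsymm : ∀ μ ν, T μ ν = T ν μ)
    (hcons : ∀ ν, ∑ μ, lowerIdx k μ * T μ ν = 0) : of T * of (ωt k) = 0 := by
  have hT : (of T)ᵀ = of T := by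
    ext μ ν
    exact hsymm ν μ
  rw [← transpose_ωt, ← hT, ← transpose_mul, ωt_mul_of_conserved hcons, transpose_zero]

lemma θt_mul_of_conserved (hcons : ∀ ν, ∑ μ, lowerIdx k μ * T μ ν = 0) :
    of (θt k) * of T = of eta * of T := by
  rw [θt_eq_eta_sub_ωt, sub_mul, ωt_mul_of_conserved hcons, sub_zero]

lemma mul_θt_of_conserved (hsymm : ∀ μ ν, T μ ν = T ν μ)
    (hcons : ∀ ν, ∑ μ, lowerIdx k μ * T μ ν = 0) : of T * of (θt k) = of T * of eta := by
  rw [θt_eq_eta_sub_ωt, mul_sub, mul_ωt_of_conserved hsymm hcons, sub_zero]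

lemma satur_P2 (hsymm : ∀ μ ν, T μ ν = T ν μ) (hcons : ∀ ν, ∑ μ, lowerIdx k μ * T μ ν = 0) :
    satur (P2 k) T = Tsq T - (1 / 2) * (trT T) ^ 2 := by
  have h : satur (crossTensor (of (θt k)) (of (θt k))) T = Tsq T := by
    rw [← satur_crossTensor_eta, satur_crossTensor, satur_crossTensor,
      θt_mul_of_conserved hcons, mul_θt_of_conserved hsymm hcons]
  rw [P2_eq, satur_smul, satur_add, satur_add, satur_smul, satur_swapTensor _ _ hsymm, h,
    satur_outerTensor, transpose_θt, θt_mul_of_conserved hcons, trace_eta_mul]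
  ring

lemma satur_P1 (hsymm : ∀ μ ν, T μ ν = T ν μ) (hcons : ∀ ν, ∑ μ, lowerIdx k μ * T μ ν = 0) :
    satur (P1 k) T = 0 := by
  simp [P1_eq, satur_smul, satur_add, satur_swapTensor _ _ hsymm, satur_crossTensor,
    ωt_mul_of_conserved hcons, mul_ωt_of_conserved hsymm hcons]

lemma satur_P0s (hcons : ∀ ν, ∑ μ, lowerIdx k μ * T μ ν = 0) :
    satur (P0s k) T = (1 / 2) * (trT T) ^ 2 := by
  rw [P0s_eq, satur_smul, satur_outerTensor, transpose_θt, θt_mul_of_conserved hcons,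
    trace_eta_mul, sq]

lemma satur_P0w (hcons : ∀ ν, ∑ μ, lowerIdx k μ * T μ ν = 0) : satur (P0w k) T = 0 := by
  simp [P0w_eq, satur_outerTensor, transpose_ωt, ωt_mul_of_conserved hcons]

lemma satur_P0sw (hcons : ∀ ν, ∑ μ, lowerIdx k μ * T μ ν = 0) : satur (P0sw k) T = 0 := by
  simp [P0sw_eq, satur_smul, satur_outerTensor, transpose_ωt, ωt_mul_of_conserved hcons]

lemma satur_P0ws (hcons : ∀ ν, ∑ μ, lowerIdx k μ * T μ ν = 0) : satur (P0ws k) T = 0 := by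
  simp [P0ws_eq, satur_smul, satur_outerTensor, transpose_ωt, ωt_mul_of_conserved hcons]

end Conserved

/-- A function agreeing with a continuous one on a punctured neighbourhood has its limit. -/
lemma tendsto_punctured_of_eventuallyEq {f g : ℝ → ℝ} {a b : ℝ} (hg : ContinuousAt g a)
    (hb : g a = b) (hfg : ∀ᶠ x in 𝓝[≠] a, g x = f x) : Tendsto f (𝓝[≠] a) (𝓝 b) :=
  hb ▸ (hg.tendsto.mono_left nhdsWithin_le_nhds).congr' hfg

/-- Saturated propagator of the BHT (new massive gravity) model, together with
its residues at the massive and massless poles. -/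
theorem BHT_saturated_propagator (σ α β κ Λ : ℝ)
    (hβ : 0 < β) (hκ : κ ≠ 0) (hΛ : Λ ≠ 0)
    (hσ : σ = -1) (hα : α = -3 * β / 8)
    (m2sq : ℝ) (hm2 : m2sq = 4 / (β * κ^2))
    (k : Fin 3 → ℝ) (hk : ksq k ≠ 0) (hk2 : ksq k ≠ m2sq)
    (T : Fin 3 → Fin 3 → ℝ) (hsymm : ∀ μ ν, T μ ν = T ν μ)
    (hcons : ∀ ν, ∑ μ, lowerIdx k μ * T μ ν = 0)
    (Oinv : Tensor4)
    (hOinv : Oinv = (2 * Λ / ksq k) • P1 k +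
      (ksq k * (σ + β * κ^2 * ksq k / 4))⁻¹ • P2 k +
      (-σ * ksq k + 2 * α * κ^2 * (ksq k)^2 + (3/4) * β * κ^2 * (ksq k)^2)⁻¹ • P0s k +
      (Real.sqrt 2 *
        (-σ * ksq k + 2 * α * κ^2 * (ksq k)^2 + (3/4) * β * κ^2 * (ksq k)^2)⁻¹) •
        (P0sw k + P0ws k) +
      ((-4 * Λ * σ + 2 + 8 * Λ * α * κ^2 * ksq k + 3 * Λ * β * κ^2 * ksq k) *
        (-σ * ksq k + 2 * α * κ^2 * (ksq k)^2 + (3/4) * β * κ^2 * (ksq k)^2)⁻¹) • P0w k) :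
    satur Oinv T =
      (1 / (ksq k - m2sq) - 1 / ksq k) * (Tsq T - (1/2) * (trT T)^2) +
      (trT T)^2 / (2 * ksq k) ∧
    Filter.Tendsto
      (fun x : ℝ => (x - m2sq) *
        ((1 / (x - m2sq) - 1 / x) * (Tsq T - (1/2) * (trT T)^2) + (trT T)^2 / (2 * x)))
      (𝓝[≠] m2sq) (𝓝 (Tsq T - (1/2) * (trT T)^2)) ∧
    Filter.Tendsto
      (fun x : ℝ => x *
        ((1 / (x - m2sq) - 1 / x) * (Tsq T - (1/2) * (trT T)^2) + (trT T)^2 / (2 * x)))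
      (𝓝[≠] (0:ℝ)) (𝓝 (-(Tsq T - (trT T)^2))) := by
  have hβκ : β * κ ^ 2 ≠ 0 := mul_ne_zero hβ.ne' (pow_ne_zero 2 hκ)
  have hm0 : m2sq ≠ 0 := hm2 ▸ div_ne_zero four_ne_zero hβκ
  have hβm : β * κ ^ 2 = 4 / m2sq := by
    rw [hm2]
    field_simp
  refine ⟨?_, ?_, ?_⟩
  · have hsub : ksq k - m2sq ≠ 0 := sub_ne_zero.mpr hk2
    have h2 : (ksq k * (σ + β * κ ^ 2 * ksq k / 4))⁻¹ = 1 / (ksq k - m2sq) - 1 / ksq k := by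
      have h : σ + β * κ ^ 2 * ksq k / 4 = (ksq k - m2sq) / m2sq := by
        rw [hβm, hσ]
        field_simp
        ring
      rw [h]
      field_simp
      ring
    have h0 : -σ * ksq k + 2 * α * κ ^ 2 * (ksq k) ^ 2 + (3 / 4) * β * κ ^ 2 * (ksq k) ^ 2
        = ksq k := by
      rw [hσ, hα]
      ring
    rw [hOinv, h2, h0]
    simp only [satur_add, satur_smul, satur_P1 hsymm hcons, satur_P2 hsymm hcons,
      satur_P0s hcons, satur_P0w hcons, satur_P0sw hcons, satur_P0ws hcons]
    field_simp
    ring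
  · refine tendsto_punctured_of_eventuallyEq
      (g := fun x => (1 - (x - m2sq) / x) * (Tsq T - (1/2) * (trT T)^2) +
        (x - m2sq) * ((trT T)^2 / (2 * x))) ?_ (by simp) ?_
    · have : 2 * m2sq ≠ 0 := mul_ne_zero two_ne_zero hm0
      fun_prop (disch := assumption)
    · filter_upwards [self_mem_nhdsWithin] with x hx
      have hx' : x - m2sq ≠ 0 := sub_ne_zero.mpr hx
      linear_combination (-(Tsq T - (1/2) * (trT T)^2)) * mul_one_div_cancel hx'
  · refine tendsto_punctured_of_eventuallyEq
      (g := fun x => (x / (x - m2sq) - 1) * (Tsq T - (1/2) * (trT T)^2) + (trT T)^2 / 2)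
      ?_ (by simp; ring) ?_
    · have : (0 : ℝ) - m2sq ≠ 0 := by simpa using hm0
      fun_prop (disch := assumption)
    · filter_upwards [self_mem_nhdsWithin] with x hx
      have hx' : x ≠ 0 := hx
      linear_combination ((Tsq T - (1/2) * (trT T)^2) - (trT T)^2 / 2) * mul_one_div_cancel hx'
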